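/- arXiv:1705.08331 — 3 statements merged into one kernel-verified Lean document; each statement's English description precedes it below -/
import Mathlib

section
/- Consider the model y ∼ N_n(0, Λτ² + Iσ²) where Λ = diag(λ₁,…,λₙ) is a known diagonal matrix with positive entries, with true parameter θ₀ = (τ₀², σ₀²). Define q_i(θ) = y_i²/(λ_iτ² + σ²) − log((λ_iτ₀² + σ₀²)/(λ_iτ² + σ²)) and Q_n(θ) = (1/n)Σ_{i=1}^n q_i(θ). Assume θ₀ ∈ Θ, a compact subset of [0,∞) × (0,∞), and let θ̂_n = argmin_Θ Q_n(θ). If for each n the empirical distribution F_n of the diagonal entries of Λ has support contained in [0, λ̄] for a fixed λ̄, and F_n converges weakly to a non-degenerate distribution F₀ as n → ∞, then θ̂_n → θ₀ in probability as n → ∞. -/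
open MeasureTheory ProbabilityTheory Real Set Matrix

noncomputable section

/-- pdf of the Student t distribution with `q` degrees of freedom. -/
def tPdf (q : ℝ) (x : ℝ) : ℝ :=
  (Real.Gamma ((q + 1) / 2) / (Real.sqrt (q * Real.pi) * Real.Gamma (q / 2))) *
    (1 + x ^ 2 / q) ^ (-(q + 1) / 2)

/-- CDF of the Student t distribution with `q` degrees of freedom. -/
def tCdf (q : ℝ) (x : ℝ) : ℝ := ∫ t in Set.Iic x, tPdf q t

/-- `p`-th quantile of the Student t distribution with `q` degrees of freedom. -/
def tQuantile (q : ℝ) (p : ℝ) : ℝ := sInf {x : ℝ | p ≤ tCdf q x}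

/-- standard normal CDF -/
def Phi (x : ℝ) : ℝ := ((gaussianReal 0 1) (Set.Iic x)).toReal

/-- standard normal quantile function -/
def PhiInv (p : ℝ) : ℝ := sInf {x : ℝ | p ≤ Phi x}

/-- the function `g(s) = Φ⁻¹(αs) − Φ⁻¹(α(1−s))` -/
def gfun (α : ℝ) (s : ℝ) : ℝ := PhiInv (α * s) - PhiInv (α * (1 - s))

/-- inverse of `g` -/
def gInv (α : ℝ) : ℝ → ℝ := Function.invFun (gfun α)

/-- chi-squared measure with `q` degrees of freedom -/
def chiSq (q : ℝ) : Measure ℝ := gammaMeasure (q / 2) (1 / 2)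

/-- The FAB confidence set with spending function `s`, based on t-quantiles
with `q` degrees of freedom. -/
def fabSet (q α : ℝ) (s : ℝ → ℝ) (θhat σhat : ℝ) : Set ℝ :=
  {θ : ℝ | θhat + σhat * tQuantile q (α * (1 - s θ)) < θ ∧
           θ < θhat + σhat * tQuantile q (1 - α * s θ)}

/-- The FAB confidence set with spending function `s`, based on normal quantiles. -/
def fabSetZ (α : ℝ) (s : ℝ → ℝ) (θhat σ : ℝ) : Set ℝ :=
  {θ : ℝ | θhat + σ * PhiInv (α * (1 - s θ)) < θ ∧
           θ < θhat + σ * PhiInv (1 - α * s θ)}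

/-- A measure on `Fin m → ℝ` is multivariate Gaussian with the given mean vector and
covariance matrix iff every linear functional has the corresponding univariate
Gaussian distribution. -/
def IsGaussianVec {m : ℕ} (μ : Measure (Fin m → ℝ)) (mean : Fin m → ℝ)
    (S : Matrix (Fin m) (Fin m) ℝ) : Prop :=
  ∀ u : Fin m → ℝ,
    Measure.map (fun x => ∑ i, u i * x i) μ =
      gaussianReal (∑ i, u i * mean i) (Real.toNNReal (u ⬝ᵥ S.mulVec u))


/-- `q_i(θ)`: minus twice the contribution of `y_i` to the log-likelihood (plus a
constant) in the diagonal-covariance model, with true parameter `(τ₀², σ₀²)` and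
`θ = (τ², σ²)`. -/
def qContrib (τ0 σ0 : ℝ) (lam : ℝ) (θ : ℝ × ℝ) (yi : ℝ) : ℝ :=
  yi ^ 2 / (lam * θ.1 + θ.2) - Real.log ((lam * τ0 + σ0) / (lam * θ.1 + θ.2))

/-- `Q_n(θ) = (1/n) ∑ q_i(θ)`. -/
def Qobj {n : ℕ} (τ0 σ0 : ℝ) (lam : Fin n → ℝ) (yv : Fin n → ℝ) (θ : ℝ × ℝ) : ℝ :=
  (∑ i, qContrib τ0 σ0 (lam i) θ (yv i)) / n

/-- The limiting population objective `Q₀(θ)`. -/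
def Qlim (F0 : Measure ℝ) (τ0 σ0 : ℝ) (θ : ℝ × ℝ) : ℝ :=
  ∫ lam, ((lam * τ0 + σ0) / (lam * θ.1 + θ.2)
      - Real.log ((lam * τ0 + σ0) / (lam * θ.1 + θ.2))) ∂F0

end

open MeasureTheory ProbabilityTheory Real Set Matrix Filter


lemma aux_memLp_sq (v : NNReal) : MemLp (fun x : ℝ => x ^ 2) 2 (gaussianReal 0 v) := by
  have h4 : MemLp (id : ℝ → ℝ) 4 (gaussianReal 0 v) := memLp_id_gaussianReal' 4 (by simp)
  have h := (h4.integrable_norm_pow (p := 4) (by simp))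
  rw [memLp_two_iff_integrable_sq (by fun_prop)]
  refine h.congr (ae_of_all _ fun x => ?_)
  simp only [id, Real.norm_eq_abs]
  rw [show (4:ℕ) = 2 * 2 from rfl, pow_mul, sq_abs]

lemma aux_integral_sq (v : NNReal) : ∫ x : ℝ, x ^ 2 ∂(gaussianReal 0 v) = v := by
  have h := variance_id_gaussianReal (μ := 0) (v := v)
  rw [variance_eq_sub (memLp_id_gaussianReal' 2 (by simp))] at h
  simpa [integral_id_gaussianReal] using h

lemma aux_fourth : ∃ K : ℝ, 0 ≤ K ∧ ∀ v : NNReal,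
    Var[fun x : ℝ => x ^ 2 ; gaussianReal 0 v] ≤ K * (v : ℝ) ^ 2 := by
  refine ⟨∫ x : ℝ, x ^ 4 ∂(gaussianReal 0 1), integral_nonneg fun x => by positivity, fun v => ?_⟩
  refine (variance_le_expectation_sq (by fun_prop)).trans (le_of_eq ?_)
  have hm := gaussianReal_map_const_mul (μ := 0) (v := 1) (√(v:ℝ))
  have hv : gaussianReal 0 v = (gaussianReal 0 1).map (fun x => √(v:ℝ) * x) := by
    rw [hm]
    congr 1
    · simp
    · ext; simp
  rw [hv, integral_map (by fun_prop) (by fun_prop), ← integral_mul_const]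
  congr 1
  ext x
  have : √(v:ℝ) ^ 2 = v := Real.sq_sqrt v.2
  simp only [Pi.pow_apply]
  calc ((√(v:ℝ) * x) ^ 2) ^ 2 = x ^ 4 * (√(v:ℝ) ^ 2) ^ 2 := by ring
    _ = _ := by rw [this]

lemma aux_cheb (K : ℝ) (hK0 : 0 ≤ K) (hK : ∀ v : NNReal,
    Var[fun x : ℝ => x ^ 2 ; gaussianReal 0 v] ≤ K * (v : ℝ) ^ 2)
    (n : ℕ) (hn : 0 < n) (v : Fin n → ℝ) (w : Fin n → ℝ) (V B δ : ℝ) (hδ : 0 < δ)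
    (hv : ∀ i, 0 ≤ v i ∧ v i ≤ V) (hw : ∀ i, |w i| ≤ B) :
    (Measure.pi fun i => gaussianReal 0 (Real.toNNReal (v i)))
      {x : Fin n → ℝ | δ ≤ |(∑ i, w i * (x i ^ 2 - v i)) / n|} ≤
      ENNReal.ofReal ((B ^ 2 * K * V ^ 2 / δ ^ 2) / n) := by
  have hn' : (0:ℝ) < n := by exact_mod_cast hn
  set μ : Fin n → Measure ℝ := fun i => gaussianReal 0 (Real.toNNReal (v i)) with hμ
  have hL : ∀ i, MemLp (fun x : ℝ => w i * (x ^ 2 - v i)) 2 (μ i) := fun i =>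
    (((aux_memLp_sq _).sub (memLp_const (v i))).const_mul (w i))
  have hL' : ∀ i, MemLp (fun x : Fin n → ℝ => w i * (x i ^ 2 - v i)) 2 (Measure.pi μ) := fun i =>
    (hL i).comp_measurePreserving (measurePreserving_eval _ i)
  have hvar := variance_sum_pi (μ := μ) hL
  set X : (Fin n → ℝ) → ℝ := ∑ i, fun x : Fin n → ℝ => w i * (x i ^ 2 - v i) with hX
  have hXL : MemLp X 2 (Measure.pi μ) := memLp_finsetSum' _ fun i _ => hL' i
  have hXm : ∫ x, X x ∂(Measure.pi μ) = 0 := by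
    simp only [hX, Finset.sum_apply]
    rw [integral_finsetSum _ fun i _ => (hL' i).integrable (by norm_num)]
    refine Finset.sum_eq_zero fun i _ => ?_
    have hev := integral_comp_eval (X := fun _ : Fin n => ℝ) (μ := μ) (i := i)
      (f := fun x : ℝ => w i * (x ^ 2 - v i)) (by fun_prop)
    refine hev.trans ?_
    rw [integral_const_mul,
      integral_sub ((aux_memLp_sq _).integrable (by norm_num)) (integrable_const _), aux_integral_sq]
    simp [hμ, (hv i).1]
  have hVar : Var[X ; Measure.pi μ] ≤ n * (B ^ 2 * K * V ^ 2) := by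
    rw [hvar]
    calc _ ≤ ∑ i : Fin n, (B ^ 2 * K * V ^ 2) := Finset.sum_le_sum fun i _ => ?_
      _ = _ := by simp
    rw [variance_const_mul, variance_sub_const (by fun_prop)]
    have h1 := hK (Real.toNNReal (v i))
    rw [Real.coe_toNNReal _ (hv i).1] at h1
    have h2 : w i ^ 2 ≤ B ^ 2 := sq_le_sq' (by linarith [(abs_le.1 (hw i)).1]) (abs_le.1 (hw i)).2
    have h3 : v i ^ 2 ≤ V ^ 2 := pow_le_pow_left₀ (hv i).1 (hv i).2 2
    calc _ ≤ w i ^ 2 * (K * v i ^ 2) := by gcongr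
      _ ≤ B ^ 2 * (K * V ^ 2) := by gcongr
      _ = _ := by ring
  have hc := meas_ge_le_variance_div_sq hXL (c := δ * n) (by positivity)
  rw [hXm] at hc
  refine le_trans (le_of_eq ?_) (hc.trans (ENNReal.ofReal_le_ofReal ?_))
  · congr 1
    ext x
    simp only [mem_setOf_eq, sub_zero, hX, Finset.sum_apply, abs_div, Nat.abs_cast]
    rw [le_div_iff₀ hn']
  · calc _ ≤ n * (B ^ 2 * K * V ^ 2) / (δ * n) ^ 2 := by gcongr
      _ = _ := by field_simp

lemma aux_log (V a b : ℝ) (ha : 0 < a) (hb : 0 < b) (haV : a ≤ V) (hbV : b ≤ V) :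
    (b - a) ^ 2 / (4 * V ^ 2) ≤ a / b - 1 - Real.log (a / b) := by
  have hr : 0 < a / b := by positivity
  set x := √(a / b) with hx
  have hx0 : 0 < x := Real.sqrt_pos.2 hr
  have hxr : x ^ 2 = a / b := Real.sq_sqrt hr.le
  rw [← hxr, Real.log_pow]
  have h1 := Real.log_le_sub_one_of_pos hx0
  have hab : a = x ^ 2 * b := by rw [hxr]; field_simp
  have hV : 0 < V := ha.trans_le haV
  have h2 : (b - a) ^ 2 / (4 * V ^ 2) ≤ (x - 1) ^ 2 := by
    rw [div_le_iff₀ (by positivity)]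
    have h3 : (b - a) ^ 2 = (x - 1) ^ 2 * ((x + 1) ^ 2 * b ^ 2) := by rw [hab]; ring
    rw [h3]
    refine mul_le_mul_of_nonneg_left ?_ (sq_nonneg _)
    have : (x + 1) ^ 2 * b ^ 2 ≤ 2 * (a + b) * b := by
      rw [hab]; nlinarith [mul_nonneg (sq_nonneg (x - 1)) (sq_nonneg b)]
    nlinarith
  push_cast
  nlinarith

lemma aux_quad (F0 : Measure ℝ) (hF0 : IsProbabilityMeasure F0)
    (hF0nd : ∀ x, F0 ≠ Measure.dirac x) (lam : ∀ n, Fin n → ℝ) (L : ℝ)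
    (hlam : ∀ n i, lam n i ∈ Set.Ioc (0 : ℝ) L)
    (hweak : ∀ f : BoundedContinuousFunction ℝ ℝ,
      Tendsto (fun n => (∑ i, f (lam n i)) / (n : ℝ)) atTop (nhds (∫ x, f x ∂F0))) :
    ∃ c > 0, ∀ᶠ n in atTop, ∀ a b : ℝ,
      c * (a ^ 2 + b ^ 2) ≤ (∑ i, (lam n i * a + b) ^ 2) / (n : ℝ) := by
  have hL : 0 < L := (hlam 1 0).1.trans_le (hlam 1 0).2
  let cl : ℝ → ℝ := fun x => max 0 (min x L)
  have hclc : Continuous cl := by fun_prop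
  have hclb : ∀ x, 0 ≤ cl x ∧ cl x ≤ L := fun x => ⟨le_max_left _ _, max_le hL.le (min_le_right _ _)⟩
  have hcl : ∀ n i, cl (lam n i) = lam n i := fun n i => by
    simp [cl, (hlam n i).1.le, (hlam n i).2]
  let f1 : BoundedContinuousFunction ℝ ℝ := BoundedContinuousFunction.ofNormedAddCommGroup cl hclc L
    (fun x => by rw [Real.norm_eq_abs, abs_of_nonneg (hclb x).1]; exact (hclb x).2)
  let f2 : BoundedContinuousFunction ℝ ℝ := BoundedContinuousFunction.ofNormedAddCommGroup
    (fun x => cl x ^ 2) (by fun_prop) (L ^ 2)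
    (fun x => by
      rw [Real.norm_eq_abs, abs_of_nonneg (by positivity)]
      exact pow_le_pow_left₀ (hclb x).1 (hclb x).2 2)
  let f3 : BoundedContinuousFunction ℝ ℝ := BoundedContinuousFunction.ofNormedAddCommGroup
    (fun x => min 1 |x - cl x|) (by fun_prop) 1
    (fun x => by
      rw [Real.norm_eq_abs, abs_of_nonneg (by positivity)]
      exact min_le_left _ _)
  have h1 := hweak f1
  have h2 := hweak f2
  have h3 := hweak f3
  have e1 : ∀ x, f1 x = cl x := fun x => rfl
  have e2 : ∀ x, f2 x = cl x ^ 2 := fun x => rfl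
  have e3 : ∀ x, f3 x = min 1 |x - cl x| := fun x => rfl
  have i1 : Integrable cl F0 := f1.integrable F0
  have i2 : Integrable (fun x => cl x ^ 2) F0 := f2.integrable F0
  have i3 : Integrable (fun x => min 1 |x - cl x|) F0 := f3.integrable F0
  simp only [e1, hcl] at h1
  simp only [e2, hcl] at h2
  simp only [e3, hcl] at h3
  simp only [sub_self, abs_zero, zero_le_one, min_eq_right, Finset.sum_const_zero, zero_div] at h3
  have h3' := tendsto_nhds_unique h3 tendsto_const_nhds
  rw [integral_eq_zero_iff_of_nonneg (fun x => by positivity) i3] at h3'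
  set m1 := ∫ x, cl x ∂F0 with hm1
  set m2 := ∫ x, cl x ^ 2 ∂F0 with hm2
  have hvar : ∫ x, (cl x - m1) ^ 2 ∂F0 = m2 - m1 ^ 2 := by
    have : ∀ x, (cl x - m1) ^ 2 = cl x ^ 2 - 2 * m1 * cl x + m1 ^ 2 := fun x => by ring
    simp only [this]
    have ia : Integrable (fun x => cl x ^ 2 - 2 * m1 * cl x) F0 := i2.sub (i1.const_mul _)
    rw [integral_add ia (integrable_const _),
      integral_sub i2 (i1.const_mul _), integral_const_mul]
    simp [← hm1, ← hm2]; ring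
  have ivar : Integrable (fun x => (cl x - m1) ^ 2) F0 := by
    have : (fun x => (cl x - m1) ^ 2) = fun x => cl x ^ 2 - 2 * m1 * cl x + m1 ^ 2 := by
      ext x; ring
    rw [this]
    exact (i2.sub (i1.const_mul _)).add (integrable_const _)
  have hD : 0 < m2 - m1 ^ 2 := by
    have h0 : 0 ≤ m2 - m1 ^ 2 := hvar ▸ integral_nonneg fun x => by positivity
    refine h0.lt_of_ne fun h => ?_
    rw [← hvar, eq_comm, integral_eq_zero_iff_of_nonneg (fun x => by positivity) ivar] at h
    apply hF0nd m1
    have hae : (id : ℝ → ℝ) =ᵐ[F0] fun _ => m1 := by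
      filter_upwards [h, h3'] with x hx hx3
      simp only [Pi.zero_apply] at hx hx3
      have a1 : cl x = m1 := by nlinarith [pow_eq_zero_iff (two_ne_zero) |>.1 hx]
      have a2 : |x - cl x| = 0 := by
        rcases min_choice 1 |x - cl x| with h | h <;> rw [h] at hx3
        · norm_num at hx3
        · exact hx3
      have a3 := abs_eq_zero.1 a2
      simp only [id]; linarith
    calc F0 = F0.map id := Measure.map_id.symm
      _ = F0.map (fun _ => m1) := Measure.map_congr hae
      _ = Measure.dirac m1 := by simp
  have hm2n : 0 ≤ m2 := by nlinarith [sq_nonneg m1]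
  -- smallest eigenvalue ≥ det / trace
  set D := m2 - m1 ^ 2 with hDd
  let c := D / (2 * (m2 + 2))
  have hc : 0 < c := by positivity
  refine ⟨c, hc, ?_⟩
  have hlim : Tendsto (fun n => ((∑ i, lam n i ^ 2) / (n:ℝ) - c) * (1 - c) -
      ((∑ i, lam n i) / (n:ℝ)) ^ 2) atTop (nhds ((m2 - c) * (1 - c) - m1 ^ 2)) :=
    ((h2.sub_const c).mul_const _).sub (h1.pow 2)
  have hcm : c * (2 * (m2 + 2)) = D := by simp only [c]; field_simp
  have hc1 : c < 1 := by nlinarith [sq_nonneg m1]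
  have hpos : 0 < (m2 - c) * (1 - c) - m1 ^ 2 := by nlinarith [mul_pos hc hc]
  filter_upwards [hlim.eventually (lt_mem_nhds hpos), eventually_gt_atTop 0] with n hn hn0 a b
  have hn' : (0:ℝ) < n := by exact_mod_cast hn0
  have hexp : (∑ i, (lam n i * a + b) ^ 2) / (n : ℝ) =
      (∑ i, lam n i ^ 2) / (n:ℝ) * a ^ 2 + 2 * ((∑ i, lam n i) / (n:ℝ)) * (a * b) + b ^ 2 := by
    have : ∀ i, (lam n i * a + b) ^ 2 = lam n i ^ 2 * a ^ 2 + lam n i * (2 * a * b) + b ^ 2 :=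
      fun i => by ring
    simp only [this, Finset.sum_add_distrib, ← Finset.sum_mul]
    simp
    field_simp
  rw [hexp]
  generalize (∑ i, lam n i ^ 2) / (n:ℝ) = p at *
  generalize (∑ i, lam n i) / (n:ℝ) = q at *
  -- (p - c) a² + 2 q a b + (1-c) b² ≥ 0
  have key : 0 ≤ (1 - c) * ((p - c) * a ^ 2 + 2 * q * (a * b) + (1 - c) * b ^ 2) := by
    have : (1 - c) * ((p - c) * a ^ 2 + 2 * q * (a * b) + (1 - c) * b ^ 2)
      = ((p - c) * (1 - c) - q ^ 2) * a ^ 2 + ((1 - c) * b + q * a) ^ 2 := by ring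
    rw [this]; positivity
  have := nonneg_of_mul_nonneg_right key (by linarith)
  linarith

lemma aux_wlln
    (Ω : ℕ → Type) (mΩ : ∀ n, MeasurableSpace (Ω n)) (P : ∀ n, Measure (Ω n))
    (v : ∀ n, Fin n → ℝ) (V : ℝ) (hv : ∀ n i, 0 ≤ v n i ∧ v n i ≤ V)
    (y : ∀ n, Ω n → Fin n → ℝ) (hy : ∀ n, Measurable (y n))
    (hylaw : ∀ n, Measure.map (y n) (P n) =
      Measure.pi fun i => gaussianReal 0 (Real.toNNReal (v n i)))
    (w : ∀ n, Fin n → ℝ) (B : ℝ) (hw : ∀ n i, |w n i| ≤ B) (δ : ℝ) (hδ : 0 < δ) :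
    Tendsto (fun n => P n {ω | δ ≤ |(∑ i, w n i * (y n ω i ^ 2 - v n i)) / n|})
      atTop (nhds 0) := by
  obtain ⟨K, hK0, hK⟩ := aux_fourth
  have hlim : Tendsto (fun n : ℕ => ENNReal.ofReal ((B ^ 2 * K * V ^ 2 / δ ^ 2) / n))
      atTop (nhds 0) := by
    have := ENNReal.tendsto_ofReal (tendsto_const_div_atTop_nhds_zero_nat (B ^ 2 * K * V ^ 2 / δ ^ 2))
    simpa using this
  refine tendsto_of_tendsto_of_tendsto_of_le_of_le' tendsto_const_nhds hlim
    (Eventually.of_forall fun n => zero_le) ?_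
  filter_upwards [eventually_gt_atTop 0] with n hn
  have h := aux_cheb K hK0 hK n hn (v n) (w n) V B δ hδ (hv n) (hw n)
  rw [← hylaw n, Measure.map_apply (hy n) (measurableSet_le (by fun_prop) (by fun_prop))] at h
  exact h

lemma aux_term (v0 v Y : ℝ) (h0 : 0 < v0) (h : 0 < v) :
    Y / v - Real.log (v0 / v) - (Y / v0 - Real.log (v0 / v0)) =
      (1 / v - 1 / v0) * (Y - v0) + (v0 / v - 1 - Real.log (v0 / v)) := by
  rw [div_self h0.ne', Real.log_one]
  field_simp
  ring

/-- Lemma 4: consistency of the maximum likelihood estimator in the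
diagonal-covariance model `y ∼ N_n(0, Λτ² + Iσ²)`. -/
theorem diagonal_mle_consistency
    (Ω : ℕ → Type) (mΩ : ∀ n, MeasurableSpace (Ω n)) (P : ∀ n, Measure (Ω n))
    (hP : ∀ n, IsProbabilityMeasure (P n))
    (τ0 σ0 : ℝ)
    (Θ : Set (ℝ × ℝ)) (hΘc : IsCompact Θ) (hΘsub : Θ ⊆ Set.Ici 0 ×ˢ Set.Ioi 0)
    (hθ0 : (τ0, σ0) ∈ Θ)
    (lam : ∀ n, Fin n → ℝ) (lamBar : ℝ)
    (hlam : ∀ n i, lam n i ∈ Set.Ioc (0 : ℝ) lamBar)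
    (y : ∀ n, Ω n → Fin n → ℝ) (hy : ∀ n, Measurable (y n))
    (hylaw : ∀ n, Measure.map (y n) (P n) =
      Measure.pi fun i => gaussianReal 0 (Real.toNNReal (lam n i * τ0 + σ0)))
    (F0 : Measure ℝ) (hF0 : IsProbabilityMeasure F0)
    (hF0nd : ∀ x, F0 ≠ Measure.dirac x)
    (hweak : ∀ f : BoundedContinuousFunction ℝ ℝ,
      Tendsto (fun n => (∑ i, f (lam n i)) / (n : ℝ)) atTop (nhds (∫ x, f x ∂F0)))
    (θhat : ∀ n, Ω n → ℝ × ℝ)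
    (hmin : ∀ n ω, θhat n ω ∈ Θ ∧
      ∀ θ ∈ Θ, Qobj τ0 σ0 (lam n) (y n ω) (θhat n ω) ≤ Qobj τ0 σ0 (lam n) (y n ω) θ) :
    ∀ ε > 0, Tendsto (fun n => P n {ω | ε ≤ dist (θhat n ω) ((τ0, σ0) : ℝ × ℝ)})
      atTop (nhds 0) := by
  intro ε hε
  have hL : 0 < lamBar := (hlam 1 0).1.trans_le (hlam 1 0).2
  have hne : Θ.Nonempty := ⟨_, hθ0⟩
  obtain ⟨θs, hθs, hs⟩ := hΘc.exists_isMinOn hne (f := Prod.snd) continuous_snd.continuousOn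
  obtain ⟨θT, hθT, hT⟩ := hΘc.exists_isMaxOn hne (f := Prod.fst) continuous_fst.continuousOn
  obtain ⟨θS, hθS, hS⟩ := hΘc.exists_isMaxOn hne (f := Prod.snd) continuous_snd.continuousOn
  set s := θs.2
  set V := lamBar * θT.1 + θS.2 with hVd
  have hs0 : 0 < s := (hΘsub hθs).2
  have hvb : ∀ θ ∈ Θ, ∀ n i, s ≤ lam n i * θ.1 + θ.2 ∧ lam n i * θ.1 + θ.2 ≤ V := by
    intro θ hθ n i
    have h1 : 0 ≤ θ.1 := (hΘsub hθ).1
    have h2 : s ≤ θ.2 := hs hθ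
    have h3 : θ.1 ≤ θT.1 := hT hθ
    have h4 : θ.2 ≤ θS.2 := hS hθ
    have h5 := (hlam n i).1
    have h6 := (hlam n i).2
    have h7 : lam n i * θ.1 ≤ lamBar * θT.1 := by gcongr
    have h8 : 0 ≤ lam n i * θ.1 := by positivity
    constructor <;> linarith
  have hV0 : 0 < V := hs0.trans_le ((hvb _ hθ0 1 0).1.trans (hvb _ hθ0 1 0).2)
  obtain ⟨c, hc, hquad⟩ := aux_quad F0 hF0 hF0nd lam lamBar hlam hweak
  -- weights and the stochastic term
  let w : ℝ × ℝ → ∀ n, Fin n → ℝ := fun θ n i =>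
    1 / (lam n i * θ.1 + θ.2) - 1 / (lam n i * τ0 + σ0)
  have hinv : ∀ θ ∈ Θ, ∀ n i, 0 < 1 / (lam n i * θ.1 + θ.2) ∧ 1 / (lam n i * θ.1 + θ.2) ≤ 1 / s :=
    fun θ hθ n i => ⟨one_div_pos.2 (hs0.trans_le (hvb θ hθ n i).1),
      one_div_le_one_div_of_le hs0 (hvb θ hθ n i).1⟩
  have hwb : ∀ θ ∈ Θ, ∀ n i, |w θ n i| ≤ 1 / s := by
    intro θ hθ n i
    have h1 := hinv θ hθ n i
    have h2 := hinv _ hθ0 n i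
    rw [abs_le]
    constructor <;> simp only [w] <;> simp only at h2 <;> linarith
  have hlip : ∀ θ ∈ Θ, ∀ θ' ∈ Θ, ∀ n i,
      |w θ n i - w θ' n i| ≤ (lamBar + 1) / s ^ 2 * dist θ θ' := by
    intro θ hθ θ' hθ' n i
    have hA := (hvb θ hθ n i).1
    have hB := (hvb θ' hθ' n i).1
    have hA0 := hs0.trans_le hA
    have hB0 := hs0.trans_le hB
    have e : w θ n i - w θ' n i = (lam n i * (θ'.1 - θ.1) + (θ'.2 - θ.2)) /
        ((lam n i * θ.1 + θ.2) * (lam n i * θ'.1 + θ'.2)) := by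
      simp only [w]; field_simp; ring
    rw [e, abs_div, abs_of_pos (mul_pos hA0 hB0), div_le_iff₀ (mul_pos hA0 hB0)]
    have d1 : |θ'.1 - θ.1| ≤ dist θ θ' := by
      rw [dist_comm, Prod.dist_eq, ← Real.dist_eq]; exact le_max_left _ _
    have d2 : |θ'.2 - θ.2| ≤ dist θ θ' := by
      rw [dist_comm, Prod.dist_eq, ← Real.dist_eq]; exact le_max_right _ _
    have l0 := (hlam n i).1
    have l1 := (hlam n i).2
    calc |lam n i * (θ'.1 - θ.1) + (θ'.2 - θ.2)|
        ≤ |lam n i * (θ'.1 - θ.1)| + |θ'.2 - θ.2| := abs_add_le _ _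
      _ = lam n i * |θ'.1 - θ.1| + |θ'.2 - θ.2| := by rw [abs_mul, abs_of_pos l0]
      _ ≤ lamBar * dist θ θ' + dist θ θ' := by gcongr
      _ = (lamBar + 1) / s ^ 2 * dist θ θ' * (s * s) := by field_simp
      _ ≤ _ := by gcongr
  -- constants
  set κ := c / (4 * V ^ 2) * ε ^ 2 with hκd
  have hκ : 0 < κ := by positivity
  set M := (lamBar + 1) / s ^ 2 * (1 + 2 * V) with hMd
  have hM : 0 < M := by positivity
  obtain ⟨t, htΘ, htf, htc⟩ := hΘc.finite_cover_balls (e := κ / (2 * M)) (by positivity)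
  have hv0 : ∀ n i, 0 ≤ lam n i * τ0 + σ0 ∧ lam n i * τ0 + σ0 ≤ V := fun n i =>
    ⟨hs0.le.trans (hvb _ hθ0 n i).1, (hvb _ hθ0 n i).2⟩
  have hW := aux_wlln Ω mΩ P (fun n i => lam n i * τ0 + σ0) V hv0 y hy hylaw
  have hlim1 : ∀ θ ∈ htf.toFinset, Tendsto (fun n => P n {ω | κ / 2 ≤
      |(∑ i, w θ n i * (y n ω i ^ 2 - (lam n i * τ0 + σ0))) / n|}) atTop (nhds 0) := fun θ hθ =>
    hW (w θ) (1 / s) (hwb θ (htΘ (htf.mem_toFinset.1 hθ))) (κ / 2) (by positivity)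
  have hlim2 := hW (fun _ _ => 1) 1 (by simp) 1 one_pos
  have hlim := (tendsto_finsetSum htf.toFinset hlim1).add hlim2
  simp only [Finset.sum_const_zero, add_zero] at hlim
  refine tendsto_of_tendsto_of_tendsto_of_le_of_le' tendsto_const_nhds hlim
    (Eventually.of_forall fun n => zero_le) ?_
  filter_upwards [hquad, eventually_gt_atTop 0] with n hq hn0
  have hn : (0:ℝ) < n := by exact_mod_cast hn0
  refine le_trans (measure_mono ?_) ((measure_union_le
    (⋃ θ ∈ htf.toFinset, {ω | κ / 2 ≤ |(∑ i, w θ n i * (y n ω i ^ 2 - (lam n i * τ0 + σ0))) / n|})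
    {ω | 1 ≤ |(∑ i, (1:ℝ) * (y n ω i ^ 2 - (lam n i * τ0 + σ0))) / n|}).trans
    (add_le_add_left (measure_biUnion_finset_le _ _) _))
  intro ω hω
  by_contra hcon
  simp only [mem_union, mem_iUnion, not_or, not_exists, mem_setOf_eq, not_le] at hcon hω
  obtain ⟨hc1, hc2⟩ := hcon
  obtain ⟨hmem, hle⟩ := hmin n ω
  have hle0 := hle _ hθ0
  set θ := θhat n ω
  obtain ⟨θ', hθ't, hball⟩ := mem_iUnion₂.1 (htc hmem)
  have hdist : dist θ θ' < κ / (2 * M) := hball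
  have hS' := hc1 θ' (htf.mem_toFinset.2 hθ't)
  set z : Fin n → ℝ := fun i => y n ω i ^ 2 - (lam n i * τ0 + σ0) with hz
  change |(∑ i, w θ' n i * z i) / n| < κ / 2 at hS'
  change |(∑ i, (1:ℝ) * z i) / n| < 1 at hc2
  -- decomposition
  have hdec : Qobj τ0 σ0 (lam n) (y n ω) θ - Qobj τ0 σ0 (lam n) (y n ω) (τ0, σ0) =
      (∑ i, w θ n i * z i) / n + (∑ i, ((lam n i * τ0 + σ0) / (lam n i * θ.1 + θ.2) - 1 -
        Real.log ((lam n i * τ0 + σ0) / (lam n i * θ.1 + θ.2)))) / n := by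
    unfold Qobj qContrib
    rw [← sub_div, ← add_div, ← Finset.sum_sub_distrib, ← Finset.sum_add_distrib]
    congr 1
    refine Finset.sum_congr rfl fun i _ => ?_
    exact aux_term _ _ _ (hs0.trans_le (hvb _ hθ0 n i).1) (hs0.trans_le (hvb _ hmem n i).1)
  -- deterministic lower bound
  have hdet : κ ≤ (∑ i, ((lam n i * τ0 + σ0) / (lam n i * θ.1 + θ.2) - 1 -
        Real.log ((lam n i * τ0 + σ0) / (lam n i * θ.1 + θ.2)))) / n := by
    have hab := hq (θ.1 - τ0) (θ.2 - σ0)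
    have hε2 : ε ^ 2 ≤ (θ.1 - τ0) ^ 2 + (θ.2 - σ0) ^ 2 := by
      rw [Prod.dist_eq, le_max_iff, Real.dist_eq, Real.dist_eq] at hω
      rcases hω with h | h
      · have := pow_le_pow_left₀ hε.le h 2
        rw [sq_abs] at this
        simp only at this
        nlinarith [sq_nonneg (θ.2 - σ0)]
      · have := pow_le_pow_left₀ hε.le h 2
        rw [sq_abs] at this
        simp only at this
        nlinarith [sq_nonneg (θ.1 - τ0)]
    calc κ = c * ε ^ 2 / (4 * V ^ 2) := by rw [hκd]; ring
      _ ≤ c * ((θ.1 - τ0) ^ 2 + (θ.2 - σ0) ^ 2) / (4 * V ^ 2) := by gcongr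
      _ ≤ ((∑ i, (lam n i * (θ.1 - τ0) + (θ.2 - σ0)) ^ 2) / n) / (4 * V ^ 2) := by gcongr
      _ = (∑ i, (lam n i * (θ.1 - τ0) + (θ.2 - σ0)) ^ 2 / (4 * V ^ 2)) / n := by
        rw [← Finset.sum_div]; ring
      _ ≤ _ := by
        gcongr with i _
        refine le_trans (le_of_eq ?_) (aux_log V (lam n i * τ0 + σ0) (lam n i * θ.1 + θ.2)
          (hs0.trans_le (hvb _ hθ0 n i).1) (hs0.trans_le (hvb _ hmem n i).1)
          (hvb _ hθ0 n i).2 (hvb _ hmem n i).2)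
        congr 1
        ring
  -- average of |z|
  have hzabs : (∑ i, |z i|) / n ≤ 1 + 2 * V := by
    have h1 : ∀ i, |z i| ≤ 1 * z i + 2 * V := by
      intro i
      have a1 := hv0 n i
      have a2 := sq_nonneg (y n ω i)
      rw [abs_le]
      simp only [hz]
      constructor <;> linarith
    calc (∑ i, |z i|) / n ≤ (∑ i, (1 * z i + 2 * V)) / n := by
          gcongr with i _
          exact h1 i
      _ = (∑ i, (1:ℝ) * z i) / n + 2 * V := by
          rw [Finset.sum_add_distrib, add_div]
          simp
          field_simp
      _ ≤ _ := by linarith [(abs_lt.1 hc2).2]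
  have hdiff : |(∑ i, w θ n i * z i) / n - (∑ i, w θ' n i * z i) / n| < κ / 2 := by
    rw [← sub_div, ← Finset.sum_sub_distrib, abs_div, Nat.abs_cast]
    calc |∑ i, (w θ n i * z i - w θ' n i * z i)| / n
        ≤ (∑ i, |w θ n i * z i - w θ' n i * z i|) / n := by
          gcongr; exact Finset.abs_sum_le_sum_abs _ _
      _ ≤ (∑ i, (lamBar + 1) / s ^ 2 * dist θ θ' * |z i|) / n := by
          gcongr with i _
          rw [← sub_mul, abs_mul]
          gcongr
          exact hlip θ hmem θ' (htΘ hθ't) n i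
      _ = (lamBar + 1) / s ^ 2 * dist θ θ' * ((∑ i, |z i|) / n) := by
          rw [← Finset.mul_sum]; ring
      _ ≤ (lamBar + 1) / s ^ 2 * dist θ θ' * (1 + 2 * V) := by gcongr
      _ = M * dist θ θ' := by rw [hMd]; ring
      _ < M * (κ / (2 * M)) := by gcongr
      _ = κ / 2 := by field_simp
  have b1 := (abs_lt.1 hdiff).1
  have b2 := (abs_lt.1 hS').1
  linarith
end

section
/- Let y ∼ N_n(Xβ, σ²I) with X ∈ ℝ^{n×p} full rank, n > p. Let a be the j-th row of (XᵀX)^{-1}Xᵀ, P₁ = aaᵀ/(aᵀa), P_X = X(XᵀX)^{-1}Xᵀ, P₀ = I − P_X, and P₂ = P_X(I − P₁). Then y decomposes as y = y₀ + y₁ + y₂ with y_k = P_k y, the vectors y₀, y₁, y₂ are mutually statistically independent, the OLS estimate satisfies β̂_j = aᵀy₁, and σ̂² = y₀ᵀy₀/(n−p); consequently β̂_j, σ̂², and any measurable function of y₂ are mutually independent. -/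
open MeasureTheory ProbabilityTheory Real Set Matrix

noncomputable section

/-- OLS estimate `(XᵀX)⁻¹Xᵀy`. -/
def olsEstimate {n p : ℕ} (X : Matrix (Fin n) (Fin p) ℝ) (y : Fin n → ℝ) : Fin p → ℝ :=
  ((Xᵀ * X)⁻¹ * Xᵀ).mulVec y

/-- Usual unbiased residual variance estimate `‖y − Xβ̂‖²/(n − p)`. -/
def residVar {n p : ℕ} (X : Matrix (Fin n) (Fin p) ℝ) (y : Fin n → ℝ) : ℝ :=
  (∑ i, (y i - X.mulVec (olsEstimate X y) i) ^ 2) / ((n : ℝ) - (p : ℝ))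

/-- `w_j`, the square root of the `j`-th diagonal entry of `(XᵀX)⁻¹`. -/
def seMult {n p : ℕ} (X : Matrix (Fin n) (Fin p) ℝ) (j : Fin p) : ℝ :=
  Real.sqrt ((Xᵀ * X)⁻¹ j j)

/-- Projection onto the column space of `X`. -/
def projX {n p : ℕ} (X : Matrix (Fin n) (Fin p) ℝ) : Matrix (Fin n) (Fin n) ℝ :=
  X * (Xᵀ * X)⁻¹ * Xᵀ

/-- `a`, the `j`-th row of `(XᵀX)⁻¹Xᵀ`, so that `β̂_j = aᵀy`. -/
def aRow {n p : ℕ} (X : Matrix (Fin n) (Fin p) ℝ) (j : Fin p) : Fin n → ℝ :=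
  fun i => ((Xᵀ * X)⁻¹ * Xᵀ) j i

/-- `P₁ = aaᵀ/(aᵀa)`. -/
def proj1 {n p : ℕ} (X : Matrix (Fin n) (Fin p) ℝ) (j : Fin p) : Matrix (Fin n) (Fin n) ℝ :=
  (aRow X j ⬝ᵥ aRow X j)⁻¹ • Matrix.vecMulVec (aRow X j) (aRow X j)

/-- `P₂ = P_X (I − P₁)`. -/
def proj2 {n p : ℕ} (X : Matrix (Fin n) (Fin p) ℝ) (j : Fin p) : Matrix (Fin n) (Fin n) ℝ :=
  projX X * (1 - proj1 X j)

end

open MeasureTheory ProbabilityTheory Real Set Matrix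

/-- Variance of a linear functional. -/
theorem aux_var {Ω : Type*} [MeasurableSpace Ω] (P : Measure Ω)
    {n : ℕ} (m : Fin n → ℝ) (σ : ℝ) (y : Ω → Fin n → ℝ) (hy : Measurable y)
    (hlaw : IsGaussianVec (Measure.map y P) m (σ ^ 2 • (1 : Matrix (Fin n) (Fin n) ℝ)))
    (u : Fin n → ℝ) :
    Var[fun ω => u ⬝ᵥ y ω; P] = σ ^ 2 * (u ⬝ᵥ u) := by
  have h := hlaw u
  have hm : Measurable (fun x : Fin n → ℝ => ∑ i, u i * x i) := by fun_prop
  rw [Measure.map_map hm hy] at h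
  have h1 : Var[fun ω => u ⬝ᵥ y ω; P] =
      Var[id; P.map ((fun x : Fin n → ℝ => ∑ i, u i * x i) ∘ y)] := by
    rw [variance_id_map (hm.comp hy).aemeasurable]
    rfl
  rw [h1, h, variance_id_gaussianReal]
  have h0 : 0 ≤ u ⬝ᵥ u := Finset.sum_nonneg fun i _ => mul_self_nonneg (u i)
  rw [Matrix.smul_mulVec, Matrix.one_mulVec, dotProduct_smul, smul_eq_mul,
    Real.coe_toNNReal _ (by positivity)]

/-- The vector is Gaussian in the sense of Mathlib. -/
theorem aux_gauss {Ω : Type*} [MeasurableSpace Ω] (P : Measure Ω)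
    {n : ℕ} (m : Fin n → ℝ) (S : Matrix (Fin n) (Fin n) ℝ)
    (y : Ω → Fin n → ℝ) (hlaw : IsGaussianVec (Measure.map y P) m S) :
    HasGaussianLaw y P := by
  refine ⟨⟨fun L => ?_⟩⟩
  have hL : (L : (Fin n → ℝ) → ℝ) = fun x => ∑ i, L (Pi.single i 1) * x i := by
    funext x
    conv_lhs => rw [← Finset.univ_sum_single x]
    rw [map_sum]
    refine Finset.sum_congr rfl fun i _ => ?_
    have : (Pi.single i (x i) : Fin n → ℝ) = x i • Pi.single i 1 := by
      rw [← Pi.single_smul, smul_eq_mul, mul_one]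
    rw [this, map_smul, smul_eq_mul, mul_comm]
  have h := hlaw (fun i => L (Pi.single i 1))
  rw [← hL] at h
  have hLm : AEMeasurable (L : (Fin n → ℝ) → ℝ) (P.map y) := L.continuous.measurable.aemeasurable
  have hi : (P.map y)[L] = ∫ x, x ∂((P.map y).map L) := by
    rw [integral_map hLm (by fun_prop)]
  have hv : Var[L; P.map y] = Var[id; (P.map y).map L] := (variance_id_map hLm).symm
  rw [hi, hv, h, integral_id_gaussianReal, variance_id_gaussianReal, Real.toNNReal_coe]

/-- Orthogonal linear images of a spherical Gaussian vector are independent. -/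
theorem aux_indep {Ω : Type*} [MeasurableSpace Ω] (P : Measure Ω) [IsProbabilityMeasure P]
    {n : ℕ} (m : Fin n → ℝ) (σ : ℝ) (y : Ω → Fin n → ℝ) (hy : Measurable y)
    (hlaw : IsGaussianVec (Measure.map y P) m (σ ^ 2 • (1 : Matrix (Fin n) (Fin n) ℝ)))
    {ι κ : Type*} [Fintype ι] [Fintype κ] (A : Matrix ι (Fin n) ℝ) (B : Matrix κ (Fin n) ℝ)
    (hAB : A * Bᵀ = 0) :
    IndepFun (fun ω => A.mulVec (y ω)) (fun ω => B.mulVec (y ω)) P := by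
  have hG := aux_gauss P m _ y hlaw
  have hAG : HasGaussianLaw (fun ω => (A.mulVec (y ω), B.mulVec (y ω))) P :=
    hG.map_fun ((LinearMap.toContinuousLinearMap A.mulVecLin).prod
      (LinearMap.toContinuousLinearMap B.mulVecLin))
  refine HasGaussianLaw.indepFun_of_covariance_eval (X := fun i ω => A.mulVec (y ω) i)
    (Y := fun k ω => B.mulVec (y ω) k) hAG fun i k => ?_
  have hX : MemLp (fun ω => A.mulVec (y ω) i) 2 P := (hAG.fst.eval i).memLp_two
  have hY : MemLp (fun ω => B.mulVec (y ω) k) 2 P := (hAG.snd.eval k).memLp_two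
  have h := variance_fun_add hX hY
  have e1 : Var[fun ω => A.mulVec (y ω) i; P] = σ ^ 2 * (A i ⬝ᵥ A i) :=
    aux_var P m σ y hy hlaw (A i)
  have e2 : Var[fun ω => B.mulVec (y ω) k; P] = σ ^ 2 * (B k ⬝ᵥ B k) :=
    aux_var P m σ y hy hlaw (B k)
  have e3 : Var[fun ω => A.mulVec (y ω) i + B.mulVec (y ω) k; P]
      = σ ^ 2 * ((A i + B k) ⬝ᵥ (A i + B k)) := by
    rw [← aux_var P m σ y hy hlaw (A i + B k)]
    congr 1
    funext ω
    rw [add_dotProduct]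
    rfl
  have e4 : A i ⬝ᵥ B k = 0 := by
    have := congrFun (congrFun hAB i) k
    simpa [Matrix.mul_apply, dotProduct] using this
  rw [e1, e2, e3, add_dotProduct, dotProduct_add, dotProduct_add, dotProduct_comm (B k) (A i),
    e4] at h
  linarith

theorem aux_isUnit {n p : ℕ} (X : Matrix (Fin n) (Fin p) ℝ) (hX : X.rank = p) :
    IsUnit (Xᵀ * X).det := by
  have hr : (Xᵀ * X).rank = p := by rw [Matrix.rank_transpose_mul_self, hX]
  rw [← Matrix.isUnit_iff_isUnit_det, ← Matrix.mulVec_surjective_iff_isUnit]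
  have : LinearMap.range (Xᵀ * X).mulVecLin = ⊤ := by
    apply Submodule.eq_top_of_finrank_eq
    rw [← Matrix.rank, hr]
    simp
  exact LinearMap.range_eq_top.mp this

theorem aux_symm {n p : ℕ} (X : Matrix (Fin n) (Fin p) ℝ) : (projX X)ᵀ = projX X := by
  simp [projX, Matrix.transpose_mul, Matrix.transpose_nonsing_inv, Matrix.mul_assoc]

theorem aux_idem {n p : ℕ} (X : Matrix (Fin n) (Fin p) ℝ) (h : IsUnit (Xᵀ * X).det) :
    projX X * projX X = projX X := by
  have : projX X * projX X = X * (Xᵀ * X)⁻¹ * ((Xᵀ * X) * (Xᵀ * X)⁻¹) * Xᵀ := by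
    simp only [projX, Matrix.mul_assoc]
  rw [this, Matrix.mul_nonsing_inv _ h, Matrix.mul_one, projX]

theorem aux_proj_a {n p : ℕ} (X : Matrix (Fin n) (Fin p) ℝ) (h : IsUnit (Xᵀ * X).det)
    (j : Fin p) : (projX X).mulVec (aRow X j) = aRow X j := by
  have h1 : ((Xᵀ * X)⁻¹ * Xᵀ) * projX X = (Xᵀ * X)⁻¹ * Xᵀ := by
    have : ((Xᵀ * X)⁻¹ * Xᵀ) * projX X = (Xᵀ * X)⁻¹ * ((Xᵀ * X) * (Xᵀ * X)⁻¹) * Xᵀ := by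
      simp only [projX, Matrix.mul_assoc]
    rw [this, Matrix.mul_nonsing_inv _ h, Matrix.mul_one]
  rw [← aux_symm, Matrix.mulVec_transpose]
  funext i
  exact congrFun (congrFun h1 j) i

theorem aux_a_ne {n p : ℕ} (X : Matrix (Fin n) (Fin p) ℝ) (h : IsUnit (Xᵀ * X).det)
    (j : Fin p) : aRow X j ⬝ᵥ aRow X j ≠ 0 := by
  intro h0
  have ha : aRow X j = 0 := dotProduct_self_eq_zero.mp h0
  have h1 : ((Xᵀ * X)⁻¹ * Xᵀ) * X = 1 := by
    rw [Matrix.mul_assoc, Matrix.nonsing_inv_mul _ h]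
  have h2 := congrFun (congrFun h1 j) j
  rw [Matrix.mul_apply, Matrix.one_apply_eq] at h2
  have h3 : ∀ i, ((Xᵀ * X)⁻¹ * Xᵀ) j i = 0 := fun i => congrFun ha i
  simp [h3] at h2

theorem aux_symm1 {n p : ℕ} (X : Matrix (Fin n) (Fin p) ℝ) (j : Fin p) :
    (proj1 X j)ᵀ = proj1 X j := by
  rw [proj1, Matrix.transpose_smul, Matrix.transpose_vecMulVec]

theorem aux_XP1 {n p : ℕ} (X : Matrix (Fin n) (Fin p) ℝ) (h : IsUnit (Xᵀ * X).det)
    (j : Fin p) : projX X * proj1 X j = proj1 X j := by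
  rw [proj1, Matrix.mul_smul, Matrix.mul_vecMulVec, aux_proj_a X h]

theorem aux_P1X {n p : ℕ} (X : Matrix (Fin n) (Fin p) ℝ) (h : IsUnit (Xᵀ * X).det)
    (j : Fin p) : proj1 X j * projX X = proj1 X j := by
  have := congrArg Matrix.transpose (aux_XP1 X h j)
  rwa [Matrix.transpose_mul, aux_symm, aux_symm1] at this

theorem aux_P1P1 {n p : ℕ} (X : Matrix (Fin n) (Fin p) ℝ) (h : IsUnit (Xᵀ * X).det)
    (j : Fin p) : proj1 X j * proj1 X j = proj1 X j := by
  have h0 := aux_a_ne X h j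
  rw [proj1, Matrix.mul_smul, Matrix.smul_mul, Matrix.vecMulVec_mul_vecMulVec,
    Matrix.vecMulVec_smul, smul_smul (_ : ℝ)⁻¹ (aRow X j ⬝ᵥ aRow X j), inv_mul_cancel₀ h0, one_smul]

theorem aux_a_P1 {n p : ℕ} (X : Matrix (Fin n) (Fin p) ℝ) (h : IsUnit (Xᵀ * X).det)
    (j : Fin p) (v : Fin n → ℝ) : aRow X j ⬝ᵥ (proj1 X j).mulVec v = aRow X j ⬝ᵥ v := by
  have h0 := aux_a_ne X h j
  rw [proj1, Matrix.smul_mulVec, Matrix.vecMulVec_mulVec, dotProduct_smul]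
  simp only [op_smul_eq_smul, dotProduct_smul, smul_eq_mul]
  field_simp

/-- The decomposition `y = y₀ + y₁ + y₂` into independent pieces: `y₀, y₁, y₂` are
mutually independent (expressed as `y₀ ⊥ y₁` and `(y₀, y₁) ⊥ y₂`),
`β̂_j = aᵀy₁`, `σ̂² = y₀ᵀy₀/(n−p)`, and consequently `β̂_j`, `σ̂²` and any measurable
function of `y₂` are mutually independent. -/
theorem regression_decomposition_independence
    {Ω : Type*} [MeasurableSpace Ω] (P : Measure Ω) [IsProbabilityMeasure P]
    {n p : ℕ} (hnp : p < n)
    (X : Matrix (Fin n) (Fin p) ℝ) (hX : X.rank = p)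
    (β : Fin p → ℝ) (σ : ℝ) (hσ : 0 < σ)
    (y : Ω → Fin n → ℝ) (hy : Measurable y)
    (hlaw : IsGaussianVec (Measure.map y P) (X.mulVec β)
      (σ ^ 2 • (1 : Matrix (Fin n) (Fin n) ℝ)))
    (j : Fin p) :
    -- the three projection pieces
    (∀ ω, y ω = (1 - projX X).mulVec (y ω) + (proj1 X j).mulVec (y ω)
        + (proj2 X j).mulVec (y ω)) ∧
    -- mutual independence of y₀, y₁, y₂
    IndepFun (fun ω => (1 - projX X).mulVec (y ω))
      (fun ω => (proj1 X j).mulVec (y ω)) P ∧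
    IndepFun (fun ω => ((1 - projX X).mulVec (y ω), (proj1 X j).mulVec (y ω)))
      (fun ω => (proj2 X j).mulVec (y ω)) P ∧
    -- β̂_j = aᵀy₁ and σ̂² = y₀ᵀy₀/(n−p)
    (∀ ω, olsEstimate X (y ω) j = aRow X j ⬝ᵥ (proj1 X j).mulVec (y ω)) ∧
    (∀ ω, residVar X (y ω) =
      ((1 - projX X).mulVec (y ω) ⬝ᵥ (1 - projX X).mulVec (y ω)) / ((n : ℝ) - (p : ℝ))) ∧
    -- consequently β̂_j, σ̂² and any measurable function of y₂ are mutually independent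
    (∀ {γ : Type} [MeasurableSpace γ] (g : (Fin n → ℝ) → γ), Measurable g →
      IndepFun (fun ω => olsEstimate X (y ω) j) (fun ω => residVar X (y ω)) P ∧
      IndepFun (fun ω => (olsEstimate X (y ω) j, residVar X (y ω)))
        (fun ω => g ((proj2 X j).mulVec (y ω))) P) := by
  have hU := aux_isUnit X hX
  have hXX := aux_idem X hU
  have hX1 := aux_XP1 X hU j
  have h1X := aux_P1X X hU j
  have h11 := aux_P1P1 X hU j
  have hs := aux_symm X
  have hs1 := aux_symm1 X j
  have h2 : proj2 X j = projX X - proj1 X j := by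
    rw [proj2, Matrix.mul_sub, Matrix.mul_one, hX1]
  have hs2 : (proj2 X j)ᵀ = proj2 X j := by rw [h2, Matrix.transpose_sub, hs, hs1]
  have c1 : ∀ ω, y ω = (1 - projX X).mulVec (y ω) + (proj1 X j).mulVec (y ω)
        + (proj2 X j).mulVec (y ω) := by
    intro ω
    rw [← Matrix.add_mulVec, ← Matrix.add_mulVec, h2]
    have : 1 - projX X + proj1 X j + (projX X - proj1 X j) = 1 := by abel
    rw [this, Matrix.one_mulVec]
  have h01 : (1 - projX X) * (proj1 X j)ᵀ = 0 := by
    rw [hs1, Matrix.sub_mul, hX1, Matrix.one_mul, sub_self]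
  have h02 : (1 - projX X) * (proj2 X j)ᵀ = 0 := by
    rw [hs2, h2, Matrix.sub_mul, Matrix.one_mul, Matrix.mul_sub, hXX, hX1, sub_self]
  have h12 : proj1 X j * (proj2 X j)ᵀ = 0 := by
    rw [hs2, h2, Matrix.mul_sub, h1X, h11, sub_self]
  have c2 := aux_indep P _ σ y hy hlaw _ _ h01
  have c3 : IndepFun (fun ω => ((1 - projX X).mulVec (y ω), (proj1 X j).mulVec (y ω)))
      (fun ω => (proj2 X j).mulVec (y ω)) P := by
    have h := aux_indep P _ σ y hy hlaw (Matrix.fromRows (1 - projX X) (proj1 X j)) (proj2 X j)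
      (by rw [Matrix.fromRows_mul, h02, h12, Matrix.fromRows_zero])
    have h' := h.comp (φ := fun v : Fin n ⊕ Fin n → ℝ => (fun i => v (Sum.inl i),
      fun i => v (Sum.inr i))) (ψ := id) (by fun_prop) measurable_id
    exact h'
  have c4 : ∀ ω, olsEstimate X (y ω) j = aRow X j ⬝ᵥ (proj1 X j).mulVec (y ω) := by
    intro ω
    rw [aux_a_P1 X hU]
    rfl
  have c5 : ∀ ω, residVar X (y ω) =
      ((1 - projX X).mulVec (y ω) ⬝ᵥ (1 - projX X).mulVec (y ω)) / ((n : ℝ) - (p : ℝ)) := by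
    intro ω
    have e : X.mulVec (olsEstimate X (y ω)) = (projX X).mulVec (y ω) := by
      rw [olsEstimate, Matrix.mulVec_mulVec, projX, Matrix.mul_assoc]
    rw [residVar, e, Matrix.sub_mulVec, Matrix.one_mulVec]
    congr 1
    exact Finset.sum_congr rfl fun i _ => by rw [Pi.sub_apply, sq]
  refine ⟨c1, c2, c3, c4, c5, ?_⟩
  intro γ _ g hg
  have f4 : (fun ω => olsEstimate X (y ω) j) =
      fun ω => aRow X j ⬝ᵥ (proj1 X j).mulVec (y ω) := funext c4
  have f5 := funext c5
  have m1 : Measurable (fun v : Fin n → ℝ => aRow X j ⬝ᵥ v) := by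
    unfold dotProduct; fun_prop
  have m0 : Measurable (fun v : Fin n → ℝ => (v ⬝ᵥ v) / ((n : ℝ) - (p : ℝ))) := by
    unfold dotProduct; fun_prop
  constructor
  · rw [f4, f5]
    exact (c2.comp m0 m1).symm
  · simp only [c4, c5]
    exact c3.comp (φ := fun v : (Fin n → ℝ) × (Fin n → ℝ) =>
      (aRow X j ⬝ᵥ v.2, (v.1 ⬝ᵥ v.1) / ((n : ℝ) - (p : ℝ))))
      ((m1.comp measurable_snd).prodMk (m0.comp measurable_fst)) hg
end

section
/- Let F₀ be a non-degenerate probability distribution on [0, λ̄] and (τ₀², σ₀²) ∈ [0,∞) × (0,∞). Define Q₀(τ², σ²) = ∫ [ (λτ₀² + σ₀²)/(λτ² + σ²) − log((λτ₀² + σ₀²)/(λτ² + σ²)) ] dF₀(λ). Then (τ₀², σ₀²) is the unique minimizer of Q₀ over [0,∞) × (0,∞): it is the unique critical point of Q₀, and the Hessian of Q₀ at (τ₀², σ₀²) is strictly positive definite. -/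
open MeasureTheory ProbabilityTheory Real Set Matrix

open MeasureTheory ProbabilityTheory Real Set Matrix Filter

/-- the linear functional `(a, b) ↦ l * a + b` -/
def linW (l : ℝ) : ℝ × ℝ →L[ℝ] ℝ :=
  l • ContinuousLinearMap.fst ℝ ℝ ℝ + ContinuousLinearMap.snd ℝ ℝ ℝ

lemma linW_apply (l : ℝ) (v : ℝ × ℝ) : linW l v = l * v.1 + v.2 := by
  simp [linW]

lemma continuous_linW : Continuous linW := by
  unfold linW; fun_prop

lemma continuous_smulRight_linW {E : Type*} [NormedAddCommGroup E] [NormedSpace ℝ E]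
    {e : ℝ → E} (he : Continuous e) : Continuous (fun l => (linW l).smulRight (e l)) :=
  ((ContinuousLinearMap.smulRightL ℝ (ℝ × ℝ) E).continuous.comp continuous_linW).clm_apply he

lemma w_pos {b l : ℝ} {θ : ℝ × ℝ} (hl : l ∈ Set.Icc 0 b) (h2 : 0 < θ.2)
    (hb : 0 < b * θ.1 + θ.2) : 0 < l * θ.1 + θ.2 := by
  obtain ⟨h0, h1⟩ := hl
  rcases le_or_gt 0 θ.1 with h | h
  · positivity
  · nlinarith

lemma restrict_self' {F0 : Measure ℝ} {b : ℝ} (hs : F0 (Set.Icc (0 : ℝ) b)ᶜ = 0) :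
    F0.restrict (Set.Icc 0 b) = F0 :=
  Measure.restrict_eq_self_of_ae_mem (by rw [ae_iff]; exact hs)

lemma integrable_of_cont {E : Type*} [NormedAddCommGroup E] {F0 : Measure ℝ} [IsFiniteMeasure F0]
    {b : ℝ} (hs : F0 (Set.Icc (0 : ℝ) b)ᶜ = 0) {f : ℝ → E} (hf : ContinuousOn f (Set.Icc 0 b)) :
    Integrable f F0 := by
  have := hf.integrableOn_compact (μ := F0) isCompact_Icc
  rwa [IntegrableOn, restrict_self' hs] at this

lemma cont_comp {E : Type*} [NormedAddCommGroup E] [NormedSpace ℝ E] {b : ℝ}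
    {g : ℝ → ℝ → ℝ} {e : ℝ → E}
    (hg : ContinuousOn (Function.uncurry g) (Set.Icc 0 b ×ˢ Set.Ioi 0)) (he : Continuous e)
    {θ : ℝ × ℝ} (h2 : 0 < θ.2) (hb : 0 < b * θ.1 + θ.2) :
    ContinuousOn (fun l => g l (l * θ.1 + θ.2) • e l) (Set.Icc 0 b) := by
  refine ContinuousOn.smul ?_ he.continuousOn
  exact hg.comp (f := fun l : ℝ => (l, l * θ.1 + θ.2)) (by fun_prop)
    (fun l hl => ⟨hl, w_pos hl h2 hb⟩)

lemma int_smulRight_apply {E : Type*} [NormedAddCommGroup E] [NormedSpace ℝ E]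
    {F0 : Measure ℝ} [IsFiniteMeasure F0] {b : ℝ} (hs : F0 (Set.Icc (0 : ℝ) b)ᶜ = 0)
    {c : ℝ → ℝ} (hc : ContinuousOn c (Set.Icc 0 b)) {e : ℝ → E} (he : Continuous e) (v : ℝ × ℝ) :
    (∫ l, c l • (linW l).smulRight (e l) ∂F0) v = ∫ l, (c l * (l * v.1 + v.2)) • e l ∂F0 := by
  have hi : Integrable (fun l => c l • (linW l).smulRight (e l)) F0 :=
    integrable_of_cont hs (hc.smul (continuous_smulRight_linW he).continuousOn)
  rw [ContinuousLinearMap.integral_apply hi]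
  simp [linW_apply, smul_smul]

lemma int_linW_apply {F0 : Measure ℝ} [IsFiniteMeasure F0] {b : ℝ}
    (hs : F0 (Set.Icc (0 : ℝ) b)ᶜ = 0)
    {c : ℝ → ℝ} (hc : ContinuousOn c (Set.Icc 0 b)) (v : ℝ × ℝ) :
    (∫ l, c l • linW l ∂F0) v = ∫ l, c l * (l * v.1 + v.2) ∂F0 := by
  have hi : Integrable (fun l => c l • linW l) F0 :=
    integrable_of_cont hs (hc.smul continuous_linW.continuousOn)
  rw [ContinuousLinearMap.integral_apply hi]
  simp [linW_apply]

lemma U_nhds {b : ℝ} {θ : ℝ × ℝ} (h2 : 0 < θ.2) (hb : 0 < b * θ.1 + θ.2) :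
    {η : ℝ × ℝ | 0 < η.2 ∧ 0 < b * η.1 + η.2} ∈ nhds θ := by
  have : IsOpen {η : ℝ × ℝ | 0 < η.2 ∧ 0 < b * η.1 + η.2} :=
    IsOpen.and (isOpen_lt continuous_const continuous_snd)
      (isOpen_lt continuous_const ((continuous_const.mul continuous_fst).add continuous_snd))
  exact this.mem_nhds ⟨h2, hb⟩

lemma key_deriv {E : Type*} [NormedAddCommGroup E] [NormedSpace ℝ E]
    {F0 : Measure ℝ} [IsFiniteMeasure F0]
    {b : ℝ} (hs : F0 (Set.Icc (0 : ℝ) b)ᶜ = 0)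
    {g g' : ℝ → ℝ → ℝ} {e : ℝ → E}
    (hg : ContinuousOn (Function.uncurry g) (Set.Icc 0 b ×ˢ Set.Ioi 0))
    (hg' : ContinuousOn (Function.uncurry g') (Set.Icc 0 b ×ˢ Set.Ioi 0))
    (he : Continuous e)
    (hd : ∀ l ∈ Set.Icc 0 b, ∀ w, 0 < w → HasDerivAt (g l) (g' l w) w)
    {θ : ℝ × ℝ} (h2 : 0 < θ.2) (hb : 0 < b * θ.1 + θ.2) :
    HasFDerivAt (fun θ : ℝ × ℝ => ∫ l, g l (l * θ.1 + θ.2) • e l ∂F0)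
      (∫ l, g' l (l * θ.1 + θ.2) • (linW l).smulRight (e l) ∂F0) θ := by
  have hU := U_nhds h2 hb
  obtain ⟨r, hr, hrU⟩ := Metric.nhds_basis_closedBall.mem_iff.1 hU
  have hae : ∀ᵐ l ∂F0, l ∈ Set.Icc 0 b := by rw [ae_iff]; exact hs
  have he' : Continuous (fun l => (linW l).smulRight (e l)) :=
    continuous_smulRight_linW he
  have hc : ContinuousOn (fun p : ℝ × (ℝ × ℝ) =>
      g' p.1 (p.1 * p.2.1 + p.2.2) • (linW p.1).smulRight (e p.1))
      (Set.Icc 0 b ×ˢ Metric.closedBall θ r) := by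
    have he2 : Continuous (fun p : ℝ × (ℝ × ℝ) => (linW p.1).smulRight (e p.1)) :=
      he'.comp continuous_fst
    have hg2 : ContinuousOn (fun p : ℝ × (ℝ × ℝ) => g' p.1 (p.1 * p.2.1 + p.2.2))
        (Set.Icc 0 b ×ˢ Metric.closedBall θ r) :=
      hg'.comp (f := fun p : ℝ × (ℝ × ℝ) => (p.1, p.1 * p.2.1 + p.2.2)) (by fun_prop)
        (fun p hp => ⟨hp.1, w_pos hp.1 (hrU hp.2).1 (hrU hp.2).2⟩)
    exact hg2.smul he2.continuousOn
  obtain ⟨C, hC⟩ := (isCompact_Icc.prod (isCompact_closedBall θ r)).exists_bound_of_continuousOn hc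
  refine hasFDerivAt_integral_of_dominated_of_fderiv_le (s := Metric.closedBall θ r)
    (F' := fun θ l => g' l (l * θ.1 + θ.2) • (linW l).smulRight (e l)) (bound := fun _ => C)
    (Metric.closedBall_mem_nhds _ hr) ?_ ?_ ?_ ?_ (integrable_const _) ?_
  · filter_upwards [hU] with η hη
    exact (integrable_of_cont hs (cont_comp hg he hη.1 hη.2)).1
  · exact integrable_of_cont hs (cont_comp hg he h2 hb)
  · exact (integrable_of_cont hs (cont_comp hg' he' h2 hb)).1
  · filter_upwards [hae] with l hl η hη
    exact hC (l, η) ⟨hl, hη⟩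
  · filter_upwards [hae] with l hl η hη
    have h1 := hd l hl _ (w_pos hl (hrU hη).1 (hrU hη).2)
    have h3 : HasFDerivAt (fun η : ℝ × ℝ => l * η.1 + η.2) (linW l) η := by
      have h5 : (fun η : ℝ × ℝ => l * η.1 + η.2) = linW l := by
        funext η
        rw [linW_apply]
      rw [h5]
      exact (linW l).hasFDerivAt
    have h4 := (h1.comp_hasFDerivAt η h3).smul_const (e l)
    refine h4.congr_fderiv ?_
    refine ContinuousLinearMap.ext fun v => ?_
    simp [smul_smul]

lemma nondeg {F0 : Measure ℝ} [IsProbabilityMeasure F0] (hnd : ∀ x, F0 ≠ Measure.dirac x)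
    {v : ℝ × ℝ} (h : ∀ᵐ l ∂F0, l * v.1 + v.2 = 0) : v = 0 := by
  by_cases h1 : v.1 = 0
  · obtain ⟨l, hl⟩ := h.exists
    ext
    · exact h1
    · simpa [h1] using hl
  · exfalso
    apply hnd (-v.2 / v.1)
    have h3 : (fun l : ℝ => l) =ᵐ[F0] fun _ => -v.2 / v.1 := by
      filter_upwards [h] with l hl
      field_simp
      linarith
    have h4 := Measure.map_congr (mβ := inferInstance) h3
    rw [Measure.map_id', Measure.map_const] at h4
    simpa using h4

lemma Qlim_strict {b τ0 σ0 : ℝ} (hσ0 : 0 < σ0) (hb0 : 0 < b * τ0 + σ0)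
    {F0 : Measure ℝ} [IsProbabilityMeasure F0]
    (hs : F0 (Set.Icc (0 : ℝ) b)ᶜ = 0) (hnd : ∀ x, F0 ≠ Measure.dirac x)
    {θ : ℝ × ℝ} (h2 : 0 < θ.2) (hb : 0 < b * θ.1 + θ.2) (hne : θ ≠ (τ0, σ0)) :
    Qlim F0 τ0 σ0 (τ0, σ0) < Qlim F0 τ0 σ0 θ := by
  have hae : ∀ᵐ l ∂F0, l ∈ Set.Icc 0 b := by rw [ae_iff]; exact hs
  have hw0 : ∀ l ∈ Set.Icc 0 b, 0 < l * τ0 + σ0 := fun l hl =>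
    w_pos (θ := (τ0, σ0)) hl hσ0 hb0
  have hw : ∀ l ∈ Set.Icc 0 b, 0 < l * θ.1 + θ.2 := fun l hl => w_pos hl h2 hb
  have e0 : Qlim F0 τ0 σ0 (τ0, σ0) = ∫ _l, (1 : ℝ) ∂F0 := by
    unfold Qlim
    apply integral_congr_ae
    filter_upwards [hae] with l hl
    simp [div_self (hw0 l hl).ne']
  have hint : Integrable (fun lam => (lam * τ0 + σ0) / (lam * θ.1 + θ.2)
      - Real.log ((lam * τ0 + σ0) / (lam * θ.1 + θ.2))) F0 := by
    apply integrable_of_cont hs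
    have hq : ContinuousOn (fun lam => (lam * τ0 + σ0) / (lam * θ.1 + θ.2)) (Set.Icc 0 b) :=
      ContinuousOn.div (by fun_prop) (by fun_prop) (fun l hl => (hw l hl).ne')
    exact hq.sub (hq.log (fun l hl => (div_pos (hw0 l hl) (hw l hl)).ne'))
  have hnn : ∀ᵐ l ∂F0, 0 ≤ (l * τ0 + σ0) / (l * θ.1 + θ.2)
      - Real.log ((l * τ0 + σ0) / (l * θ.1 + θ.2)) - 1 := by
    filter_upwards [hae] with l hl
    have := Real.log_le_sub_one_of_pos (div_pos (hw0 l hl) (hw l hl))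
    linarith
  have hsub : Qlim F0 τ0 σ0 θ - Qlim F0 τ0 σ0 (τ0, σ0) = ∫ l, ((l * τ0 + σ0) / (l * θ.1 + θ.2)
      - Real.log ((l * τ0 + σ0) / (l * θ.1 + θ.2)) - 1) ∂F0 := by
    rw [e0, Qlim, ← integral_sub hint (integrable_const _)]
  rw [← sub_pos, hsub]
  refine lt_of_le_of_ne (integral_nonneg_of_ae hnn) (fun h0 => hne ?_)
  have hz := (integral_eq_zero_iff_of_nonneg_ae hnn (hint.sub (integrable_const _))).1 h0.symm
  have : θ - (τ0, σ0) = 0 := by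
    apply nondeg hnd
    filter_upwards [hz, hae] with l hl hl'
    by_contra hc
    have hx : (l * τ0 + σ0) / (l * θ.1 + θ.2) ≠ 1 := by
      intro h
      rw [div_eq_one_iff_eq (hw l hl').ne'] at h
      apply hc
      simp
      linarith
    have := Real.log_lt_sub_one_of_pos (div_pos (hw0 l hl') (hw l hl')) hx
    simp at hl
    linarith
  exact sub_eq_zero.1 this

lemma Qlim_hasFDerivAt {b τ0 σ0 : ℝ} (hσ0 : 0 < σ0) (hb0 : 0 < b * τ0 + σ0)
    {F0 : Measure ℝ} [IsProbabilityMeasure F0]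
    (hs : F0 (Set.Icc (0 : ℝ) b)ᶜ = 0)
    {θ : ℝ × ℝ} (h2 : 0 < θ.2) (hb : 0 < b * θ.1 + θ.2) :
    HasFDerivAt (Qlim F0 τ0 σ0)
      (∫ l, (1 / (l * θ.1 + θ.2) - (l * τ0 + σ0) / (l * θ.1 + θ.2) ^ 2) • linW l ∂F0) θ := by
  have hw0 : ∀ l ∈ Set.Icc 0 b, 0 < l * τ0 + σ0 := fun l hl =>
    w_pos (θ := (τ0, σ0)) hl hσ0 hb0
  have := key_deriv hs (g := fun l w => (l * τ0 + σ0) / w - Real.log ((l * τ0 + σ0) / w))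
    (g' := fun l w => 1 / w - (l * τ0 + σ0) / w ^ 2) (e := fun _ => (1 : ℝ))
    ?_ ?_ continuous_const ?_ h2 hb
  · have h5 : Qlim F0 τ0 σ0 = fun θ : ℝ × ℝ => ∫ l, ((l * τ0 + σ0) / (l * θ.1 + θ.2)
        - Real.log ((l * τ0 + σ0) / (l * θ.1 + θ.2))) • (1 : ℝ) ∂F0 := by
      funext η
      simp [Qlim]
    have h6 : ∀ l, (linW l).smulRight (1 : ℝ) = linW l := fun l => by
      refine ContinuousLinearMap.ext fun v => ?_
      simp
    simp only [h6] at this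
    rw [h5]
    exact this
  · have hq : ContinuousOn (fun p : ℝ × ℝ => (p.1 * τ0 + σ0) / p.2) (Set.Icc 0 b ×ˢ Set.Ioi 0) :=
      ContinuousOn.div (by fun_prop) (by fun_prop) (fun p hp => (ne_of_gt hp.2))
    exact hq.sub (hq.log (fun p hp => (div_pos (hw0 _ hp.1) hp.2).ne'))
  · exact ContinuousOn.sub
      (ContinuousOn.div (by fun_prop) (by fun_prop) (fun p hp => (ne_of_gt hp.2)))
      (ContinuousOn.div (by fun_prop) (by fun_prop) (fun p hp => pow_ne_zero 2 (ne_of_gt hp.2)))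
  · intro l hl w hw
    have h0 := hw0 l hl
    have hq : HasDerivAt (fun w => (l * τ0 + σ0) / w) (-(l * τ0 + σ0) / w ^ 2) w := by
      have := (hasDerivAt_const w (l * τ0 + σ0)).div (hasDerivAt_id w) hw.ne'
      refine this.congr_deriv ?_
      simp
    have := hq.sub (hq.log (div_pos h0 hw).ne')
    refine this.congr_deriv ?_
    field_simp
    ring

lemma Qlim_hess {b τ0 σ0 : ℝ} (hσ0 : 0 < σ0) (hb0 : 0 < b * τ0 + σ0)
    {F0 : Measure ℝ} [IsProbabilityMeasure F0]
    (hs : F0 (Set.Icc (0 : ℝ) b)ᶜ = 0) :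
    HasFDerivAt (fderiv ℝ (Qlim F0 τ0 σ0))
      (∫ l, (-1 / (l * τ0 + σ0) ^ 2 + 2 * (l * τ0 + σ0) / (l * τ0 + σ0) ^ 3) •
        (linW l).smulRight (linW l) ∂F0) (τ0, σ0) := by
  have := key_deriv hs (g := fun l w => 1 / w - (l * τ0 + σ0) / w ^ 2)
    (g' := fun l w => -1 / w ^ 2 + 2 * (l * τ0 + σ0) / w ^ 3) (e := linW)
    ?_ ?_ continuous_linW ?_ (θ := (τ0, σ0)) hσ0 hb0
  · refine this.congr_of_eventuallyEq ?_
    filter_upwards [U_nhds (b := b) (θ := (τ0, σ0)) hσ0 hb0] with η hη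
    exact (Qlim_hasFDerivAt hσ0 hb0 hs hη.1 hη.2).fderiv
  · exact ContinuousOn.sub
      (ContinuousOn.div (by fun_prop) (by fun_prop) (fun p hp => (ne_of_gt hp.2)))
      (ContinuousOn.div (by fun_prop) (by fun_prop) (fun p hp => pow_ne_zero 2 (ne_of_gt hp.2)))
  · exact ContinuousOn.add
      (ContinuousOn.div (by fun_prop) (by fun_prop) (fun p hp => pow_ne_zero 2 (ne_of_gt hp.2)))
      (ContinuousOn.div (by fun_prop) (by fun_prop) (fun p hp => pow_ne_zero 3 (ne_of_gt hp.2)))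
  · intro l hl w hw
    have h1 := (hasDerivAt_const w (1 : ℝ)).div (hasDerivAt_id w) hw.ne'
    have h2 := (hasDerivAt_const w (l * τ0 + σ0)).div (hasDerivAt_pow 2 w) (pow_ne_zero 2 hw.ne')
    refine (h1.sub h2).congr_deriv ?_
    simp
    field_simp
    ring

/-- `Q₀` is uniquely minimized at `θ₀ = (τ₀², σ₀²)`: `θ₀` is a strict global minimizer
over `[0,∞) × (0,∞)`, it is the unique critical point of `Q₀` (on the open region), and
the Hessian of `Q₀` at `θ₀` is strictly positive definite. -/
theorem Qlim_unique_minimizer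
    (τ0 σ0 : ℝ) (hτ0 : 0 ≤ τ0) (hσ0 : 0 < σ0)
    (lamBar : ℝ) (hlamBar : 0 < lamBar)
    (F0 : Measure ℝ) (hF0 : IsProbabilityMeasure F0)
    (hF0supp : F0 (Set.Icc (0 : ℝ) lamBar)ᶜ = 0)
    (hF0nd : ∀ x, F0 ≠ Measure.dirac x) :
    -- unique global minimizer
    (∀ θ : ℝ × ℝ, 0 ≤ θ.1 → 0 < θ.2 → θ ≠ (τ0, σ0) →
      Qlim F0 τ0 σ0 (τ0, σ0) < Qlim F0 τ0 σ0 θ) ∧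
    -- unique critical point
    (∀ θ : ℝ × ℝ, 0 < θ.1 → 0 < θ.2 →
      fderiv ℝ (Qlim F0 τ0 σ0) θ = 0 → θ = (τ0, σ0)) ∧
    -- strictly positive definite Hessian at θ₀
    (∀ v : ℝ × ℝ, v ≠ 0 →
      0 < fderiv ℝ (fderiv ℝ (Qlim F0 τ0 σ0)) ((τ0, σ0) : ℝ × ℝ) v v) := by
  have hb0 : 0 < lamBar * τ0 + σ0 := by positivity
  have hae : ∀ᵐ l ∂F0, l ∈ Set.Icc 0 lamBar := by rw [ae_iff]; exact hF0supp
  have hLc := continuous_linW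
  refine ⟨?_, ?_, ?_⟩
  · intro θ h1 h2 hne
    exact Qlim_strict hσ0 hb0 hF0supp hF0nd h2 (by positivity) hne
  · intro θ h1 h2 hcrit
    have hb : 0 < lamBar * θ.1 + θ.2 := by positivity
    have hw : ∀ l ∈ Set.Icc 0 lamBar, 0 < l * θ.1 + θ.2 := fun l hl => w_pos hl h2 hb
    rw [(Qlim_hasFDerivAt hσ0 hb0 hF0supp h2 hb).fderiv] at hcrit
    have hc : ContinuousOn (fun l : ℝ => 1 / (l * θ.1 + θ.2) -
        (l * τ0 + σ0) / (l * θ.1 + θ.2) ^ 2) (Set.Icc 0 lamBar) :=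
      ContinuousOn.sub
        (ContinuousOn.div (by fun_prop) (by fun_prop) (fun l hl => (hw l hl).ne'))
        (ContinuousOn.div (by fun_prop) (by fun_prop) (fun l hl => pow_ne_zero 2 (hw l hl).ne'))
    have hv := DFunLike.congr_fun hcrit (θ - (τ0, σ0))
    rw [int_linW_apply hF0supp hc] at hv
    have hi2 := integrable_of_cont hF0supp (hc.mul (g := fun l : ℝ =>
      l * (θ - (τ0, σ0)).1 + (θ - (τ0, σ0)).2) (by fun_prop))
    have key : ∀ l ∈ Set.Icc 0 lamBar, (1 / (l * θ.1 + θ.2) - (l * τ0 + σ0) / (l * θ.1 + θ.2) ^ 2) *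
          (l * (θ - (τ0, σ0)).1 + (θ - (τ0, σ0)).2)
        = ((l * (θ - (τ0, σ0)).1 + (θ - (τ0, σ0)).2) / (l * θ.1 + θ.2)) ^ 2 := by
      intro l hl
      have := hw l hl
      simp
      field_simp
      ring
    have hz := (integral_eq_zero_iff_of_nonneg_ae (by
      filter_upwards [hae] with l hl
      exact (sq_nonneg _).trans_eq (key l hl).symm) hi2).1 hv
    refine sub_eq_zero.1 (nondeg hF0nd ?_)
    filter_upwards [hz, hae] with l hl hl'
    replace hl := (key l hl').symm.trans hl
    have := (hw l hl').ne'
    simpa [this] using hl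
  · intro v hv
    have hw : ∀ l ∈ Set.Icc 0 lamBar, 0 < l * τ0 + σ0 := fun l hl =>
      w_pos (θ := (τ0, σ0)) hl hσ0 hb0
    rw [(Qlim_hess hσ0 hb0 hF0supp).fderiv]
    have hc : ContinuousOn (fun l : ℝ => -1 / (l * τ0 + σ0) ^ 2 +
        2 * (l * τ0 + σ0) / (l * τ0 + σ0) ^ 3) (Set.Icc 0 lamBar) :=
      ContinuousOn.add
        (ContinuousOn.div (by fun_prop) (by fun_prop) (fun l hl => pow_ne_zero 2 (hw l hl).ne'))
        (ContinuousOn.div (by fun_prop) (by fun_prop) (fun l hl => pow_ne_zero 3 (hw l hl).ne'))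
    have hc1 : ContinuousOn (fun l : ℝ => (-1 / (l * τ0 + σ0) ^ 2 +
        2 * (l * τ0 + σ0) / (l * τ0 + σ0) ^ 3) * (l * v.1 + v.2)) (Set.Icc 0 lamBar) :=
      hc.mul (by fun_prop)
    have hi2 := integrable_of_cont hF0supp (hc1.mul (g := fun l : ℝ => l * v.1 + v.2)
      (by fun_prop))
    have key : ∀ l ∈ Set.Icc 0 lamBar, (-1 / (l * τ0 + σ0) ^ 2 +
        2 * (l * τ0 + σ0) / (l * τ0 + σ0) ^ 3) * (l * v.1 + v.2) * (l * v.1 + v.2)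
        = ((l * v.1 + v.2) / (l * τ0 + σ0)) ^ 2 := by
      intro l hl
      have := hw l hl
      field_simp
      ring
    have hnn : ∀ᵐ l ∂F0, 0 ≤ (-1 / (l * τ0 + σ0) ^ 2 +
        2 * (l * τ0 + σ0) / (l * τ0 + σ0) ^ 3) * (l * v.1 + v.2) * (l * v.1 + v.2) := by
      filter_upwards [hae] with l hl
      rw [key l hl]
      exact sq_nonneg _
    rw [int_smulRight_apply hF0supp hc hLc, int_linW_apply hF0supp hc1]
    refine lt_of_le_of_ne (integral_nonneg_of_ae hnn) (fun h0 => hv ?_)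
    have hz := (integral_eq_zero_iff_of_nonneg_ae hnn hi2).1 h0.symm
    refine nondeg hF0nd ?_
    filter_upwards [hz, hae] with l hl hl'
    replace hl := (key l hl').symm.trans hl
    have := (hw l hl').ne'
    simpa [this] using hl
end
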